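/- For every real number t and every integer n ≥ 1, e^{n·P(t)} ≤ ∑_{ω ∈ L_n} c_ω^t. -/

import Mathlib

open Filter

/-- The weight `c_ω` of a word `ω` over the alphabet `{0,1}` (here `false` is the
letter 0 and `true` is the letter 1): the product of `c0` over letters 0 and `c1`
over letters 1. -/
noncomputable def wt (c0 c1 : ℝ) (w : List Bool) : ℝ :=
  (w.map fun b => if b then c1 else c0).prod

/-- All words of length `n` over the alphabet `{0,1}`. -/
def allWords : ℕ → Finset (List Bool)
  | 0 => {[]}
  | n + 1 => (allWords n).biUnion fun w => {false :: w, true :: w}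

/-- Membership in the language of the S-gap shift: every maximal block of 0s lying
strictly between two 1s has length in `S`. -/
def InLang (S : Set ℕ) (w : List Bool) : Prop :=
  ∀ u v : List Bool, ∀ m : ℕ,
    w = u ++ [true] ++ List.replicate m false ++ [true] ++ v → m ∈ S

/-- Membership in the core set `G`: words of the form `0^{s₁}1 0^{s₂}1 ⋯ 0^{s_k}1`
with `k ≥ 1` and every `s_i ∈ S`. -/
def InCore (S : Set ℕ) (w : List Bool) : Prop :=
  ∃ bs : List ℕ, bs ≠ [] ∧ (∀ s ∈ bs, s ∈ S) ∧
    w = (bs.map fun s => List.replicate s false ++ [true]).flatten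

/-- `L_n`: the words of length `n` in the language of the S-gap shift. -/
noncomputable def langWords (S : Set ℕ) (n : ℕ) : Finset (List Bool) :=
  @Finset.filter _ (InLang S) (Classical.decPred _) (allWords n)

/-- `G_n`: the core words of length `n`. -/
noncomputable def coreWords (S : Set ℕ) (n : ℕ) : Finset (List Bool) :=
  @Finset.filter _ (InCore S) (Classical.decPred _) (allWords n)

theorem mem_allWords {n : ℕ} {w : List Bool} : w ∈ allWords n ↔ w.length = n := by
  induction n generalizing w with
  | zero => simp [allWords]
  | succ n ih =>
    cases w with
    | nil => simp [allWords]
    | cons b w => cases b <;> simp [allWords, ih]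

theorem mem_langWords {S : Set ℕ} {n : ℕ} {w : List Bool} :
    w ∈ langWords S n ↔ w.length = n ∧ InLang S w := by
  simp [langWords, mem_allWords]

theorem InLang.left {S : Set ℕ} {a b : List Bool} (h : InLang S (a ++ b)) : InLang S a := by
  intro u v m e
  exact h u (v ++ b) m (by simp [e])

theorem InLang.right {S : Set ℕ} {a b : List Bool} (h : InLang S (a ++ b)) : InLang S b := by
  intro u v m e
  exact h (a ++ u) v m (by simp [e])

theorem replicate_false_mem_langWords (S : Set ℕ) (n : ℕ) :
    List.replicate n false ∈ langWords S n := by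
  refine mem_langWords.2 ⟨by simp, fun u v m e => ?_⟩
  have h : true ∈ List.replicate n false := by rw [e]; simp
  simp [List.mem_replicate] at h

theorem wt_pos {c0 c1 : ℝ} (h0 : 0 < c0) (h1 : 0 < c1) (w : List Bool) : 0 < wt c0 c1 w := by
  refine List.prod_pos fun x hx => ?_
  obtain ⟨b, -, rfl⟩ := List.mem_map.1 hx
  cases b <;> simpa

theorem wt_append (c0 c1 : ℝ) (a b : List Bool) :
    wt c0 c1 (a ++ b) = wt c0 c1 a * wt c0 c1 b := by
  simp [wt]

theorem sum_langWords_pos (S : Set ℕ) {c0 c1 : ℝ} (h0 : 0 < c0) (h1 : 0 < c1) (t : ℝ) (n : ℕ) :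
    0 < ∑ ω ∈ langWords S n, wt c0 c1 ω ^ t :=
  Finset.sum_pos (fun ω _ => Real.rpow_pos_of_pos (wt_pos h0 h1 ω) t)
    ⟨_, replicate_false_mem_langWords S n⟩

/-- The partition sums of the `S`-gap shift are submultiplicative. -/
theorem sum_langWords_add_le (S : Set ℕ) {c0 c1 : ℝ} (h0 : 0 < c0) (h1 : 0 < c1) (t : ℝ)
    (m n : ℕ) :
    ∑ ω ∈ langWords S (m + n), wt c0 c1 ω ^ t ≤
      (∑ ω ∈ langWords S m, wt c0 c1 ω ^ t) * ∑ ω ∈ langWords S n, wt c0 c1 ω ^ t := by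
  have hinj : Set.InjOn (fun p : List Bool × List Bool => p.1 ++ p.2)
      (langWords S m ×ˢ langWords S n : Finset _) := by
    rintro ⟨a, b⟩ hab ⟨a', b'⟩ hab' e
    simp only [Finset.coe_product, Set.mem_prod, Finset.mem_coe, mem_langWords] at hab hab'
    obtain ⟨ha, hb⟩ := List.append_inj e (hab.1.1.trans hab'.1.1.symm)
    exact Prod.ext ha hb
  have hsub : langWords S (m + n) ⊆
      (langWords S m ×ˢ langWords S n).image fun p => p.1 ++ p.2 := by
    intro w hw
    obtain ⟨hl, hw⟩ := mem_langWords.1 hw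
    rw [← List.take_append_drop m w] at hw
    refine Finset.mem_image.2 ⟨(w.take m, w.drop m), Finset.mem_product.2 ⟨?_, ?_⟩, by simp⟩
    · exact mem_langWords.2 ⟨by simp [hl], hw.left⟩
    · exact mem_langWords.2 ⟨by simp [hl], hw.right⟩
  calc ∑ ω ∈ langWords S (m + n), wt c0 c1 ω ^ t
      ≤ ∑ ω ∈ (langWords S m ×ˢ langWords S n).image fun p => p.1 ++ p.2, wt c0 c1 ω ^ t :=
        Finset.sum_le_sum_of_subset_of_nonneg hsub fun ω _ _ =>
          (Real.rpow_pos_of_pos (wt_pos h0 h1 ω) t).le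
    _ = ∑ p ∈ langWords S m ×ˢ langWords S n, wt c0 c1 p.1 ^ t * wt c0 c1 p.2 ^ t := by
        rw [Finset.sum_image hinj]
        refine Finset.sum_congr rfl fun p _ => ?_
        rw [wt_append, Real.mul_rpow (wt_pos h0 h1 _).le (wt_pos h0 h1 _).le]
    _ = _ := by rw [Finset.sum_mul_sum, Finset.sum_product]

theorem sum_langWords_mul_le_pow (S : Set ℕ) {c0 c1 : ℝ} (h0 : 0 < c0) (h1 : 0 < c1) (t : ℝ)
    (n k : ℕ) :
    ∑ ω ∈ langWords S ((k + 1) * n), wt c0 c1 ω ^ t ≤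
      (∑ ω ∈ langWords S n, wt c0 c1 ω ^ t) ^ (k + 1) := by
  induction k with
  | zero => simp
  | succ k ih =>
    rw [Nat.succ_mul, pow_succ]
    exact (sum_langWords_add_le S h0 h1 t _ n).trans
      (mul_le_mul_of_nonneg_right ih (sum_langWords_pos S h0 h1 t n).le)

/-- For every real number t and every integer n ≥ 1,
e^{n·P(t)} ≤ ∑_{ω ∈ L_n} c_ω^t. -/
theorem stmt1
    (S : Set ℕ) (hS : S.Infinite)
    (c0 c1 cb0 cb1 : ℝ)
    (hc0 : 0 < c0) (hc0b : c0 ≤ cb0) (hcb0 : cb0 < 1)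
    (hc1 : 0 < c1) (hc1b : c1 ≤ cb1) (hcb1 : cb1 < 1)
    (P Pb : ℝ → ℝ)
    (hP : ∀ t : ℝ, Filter.Tendsto
      (fun n : ℕ => (1 / (n : ℝ)) * Real.log (∑ ω ∈ langWords S n, wt c0 c1 ω ^ t))
      Filter.atTop (nhds (P t)))
    (hPb : ∀ t : ℝ, Filter.Tendsto
      (fun n : ℕ => (1 / (n : ℝ)) * Real.log (∑ ω ∈ langWords S n, wt cb0 cb1 ω ^ t))
      Filter.atTop (nhds (Pb t)))
    :
    ∀ t : ℝ, ∀ n : ℕ, 1 ≤ n →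
      Real.exp (n * P t) ≤ ∑ ω ∈ langWords S n, wt c0 c1 ω ^ t := by
  intro t n hn
  have hZ := sum_langWords_pos S hc0 hc1 t
  have hn' : (0 : ℝ) < n := by exact_mod_cast hn
  rw [← Real.le_log_iff_exp_le (hZ n), mul_comm, ← le_div_iff₀ hn']
  have hsub : Tendsto (fun k : ℕ => (k + 1) * n) atTop atTop :=
    (tendsto_add_atTop_nat 1).atTop_mul_const' hn
  refine le_of_tendsto ((hP t).comp hsub) (Eventually.of_forall fun k => ?_)
  have hlog := Real.log_le_log (hZ _) (sum_langWords_mul_le_pow S hc0 hc1 t n k)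
  rw [Real.log_pow] at hlog
  have hk : (0 : ℝ) < k + 1 := by positivity
  simp only [Function.comp_apply]
  push_cast at hlog ⊢
  rw [one_div_mul_eq_div, div_le_div_iff₀ (by positivity) hn']
  nlinarith [mul_le_mul_of_nonneg_right hlog hn'.le]
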